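/- Let u, v, p, q : ℝ⁴ → ℝ be smooth and λ ∈ ℝ, and suppose that at every point p_t = J(u, p), p_z = J(v, p), q_t = J(u, q) + J(Δv + λ·E(u), p), and q_z = J(v, q) + J(Δu + λ·E(v), p). Then J(F2, q) + J(F1 + λ·E(F2), p) = 0 at every point, where F1 := (Δu)_t − (Δv)_z − J(u, Δu) + J(v, Δv) and F2 := v_t − u_z − J(u, v). Hence this system is a Lax representation for the reduced magnetohydrodynamics equations. -/

import Mathlib

noncomputable section

/-- Partial derivative in `t` of a function of `(t, x, y, z)`. -/
def pt (f : ℝ × ℝ × ℝ × ℝ → ℝ) (P : ℝ × ℝ × ℝ × ℝ) : ℝ :=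
  deriv (fun w => f (w, P.2.1, P.2.2.1, P.2.2.2)) P.1

/-- Partial derivative in `x` of a function of `(t, x, y, z)`. -/
def px (f : ℝ × ℝ × ℝ × ℝ → ℝ) (P : ℝ × ℝ × ℝ × ℝ) : ℝ :=
  deriv (fun w => f (P.1, w, P.2.2.1, P.2.2.2)) P.2.1

/-- Partial derivative in `y` of a function of `(t, x, y, z)`. -/
def py (f : ℝ × ℝ × ℝ × ℝ → ℝ) (P : ℝ × ℝ × ℝ × ℝ) : ℝ :=
  deriv (fun w => f (P.1, P.2.1, w, P.2.2.2)) P.2.2.1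

/-- Partial derivative in `z` of a function of `(t, x, y, z)`. -/
def pz (f : ℝ × ℝ × ℝ × ℝ → ℝ) (P : ℝ × ℝ × ℝ × ℝ) : ℝ :=
  deriv (fun w => f (P.1, P.2.1, P.2.2.1, w)) P.2.2.2

/-- Jacobi bracket `J(f, g) = f_x g_y - f_y g_x`. -/
def J (f g : ℝ × ℝ × ℝ × ℝ → ℝ) : ℝ × ℝ × ℝ × ℝ → ℝ :=
  fun P => px f P * py g P - py f P * px g P

/-- Planar Laplacian `Δf = f_xx + f_yy`. -/
def lap (f : ℝ × ℝ × ℝ × ℝ → ℝ) : ℝ × ℝ × ℝ × ℝ → ℝ :=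
  fun P => px (px f) P + py (py f) P

/-- The operator `E(f) = x f_x + y f_y - 2 f`. -/
def Eop (f : ℝ × ℝ × ℝ × ℝ → ℝ) : ℝ × ℝ × ℝ × ℝ → ℝ :=
  fun P => P.2.1 * px f P + P.2.2.1 * py f P - 2 * f P

/-- `F1 = (Δu)_t - (Δv)_z - J(u, Δu) + J(v, Δv)`. -/
def F1 (u v : ℝ × ℝ × ℝ × ℝ → ℝ) : ℝ × ℝ × ℝ × ℝ → ℝ :=
  fun P => pt (lap u) P - pz (lap v) P - J u (lap u) P + J v (lap v) P

/-- `F2 = v_t - u_z - J(u, v)`. -/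
def F2 (u v : ℝ × ℝ × ℝ × ℝ → ℝ) : ℝ × ℝ × ℝ × ℝ → ℝ :=
  fun P => pt v P - pz u P - J u v P

/-- Derivative of `f` in the direction `e`. -/
def dirDeriv (e : ℝ × ℝ × ℝ × ℝ) (f : ℝ × ℝ × ℝ × ℝ → ℝ) : ℝ × ℝ × ℝ × ℝ → ℝ :=
  fun P => fderiv ℝ f P e

section Calculus

variable {f g h : ℝ × ℝ × ℝ × ℝ → ℝ}

lemma ContDiff.differentiable_of_top (hf : ContDiff ℝ (⊤ : ℕ∞) f) : Differentiable ℝ f :=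
  hf.differentiable (by simp)

lemma ContDiff.dirDeriv (hf : ContDiff ℝ (⊤ : ℕ∞) f) (e : ℝ × ℝ × ℝ × ℝ) :
    ContDiff ℝ (⊤ : ℕ∞) (dirDeriv e f) :=
  (hf.fderiv_right (m := (⊤ : ℕ∞)) (by simp)).clm_apply contDiff_const

lemma dirDeriv_add (hf : ContDiff ℝ (⊤ : ℕ∞) f) (hg : ContDiff ℝ (⊤ : ℕ∞) g)
    (e P : ℝ × ℝ × ℝ × ℝ) :
    dirDeriv e (fun Q => f Q + g Q) P = dirDeriv e f P + dirDeriv e g P := by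
  simp only [dirDeriv]
  rw [fderiv_fun_add (hf.differentiable_of_top P) (hg.differentiable_of_top P)]
  rfl

lemma dirDeriv_sub (hf : ContDiff ℝ (⊤ : ℕ∞) f) (hg : ContDiff ℝ (⊤ : ℕ∞) g)
    (e P : ℝ × ℝ × ℝ × ℝ) :
    dirDeriv e (fun Q => f Q - g Q) P = dirDeriv e f P - dirDeriv e g P := by
  simp only [dirDeriv]
  rw [fderiv_fun_sub (hf.differentiable_of_top P) (hg.differentiable_of_top P)]
  rfl

lemma dirDeriv_mul (hf : ContDiff ℝ (⊤ : ℕ∞) f) (hg : ContDiff ℝ (⊤ : ℕ∞) g)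
    (e P : ℝ × ℝ × ℝ × ℝ) :
    dirDeriv e (fun Q => f Q * g Q) P = dirDeriv e f P * g P + f P * dirDeriv e g P := by
  simp only [dirDeriv]
  rw [fderiv_fun_mul (hf.differentiable_of_top P) (hg.differentiable_of_top P)]
  simp
  ring

lemma dirDeriv_const_mul (hf : ContDiff ℝ (⊤ : ℕ∞) f) (c : ℝ) (e P : ℝ × ℝ × ℝ × ℝ) :
    dirDeriv e (fun Q => c * f Q) P = c * dirDeriv e f P := by
  simp only [dirDeriv]
  rw [fderiv_const_mul (hf.differentiable_of_top P)]
  rfl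

lemma dirDeriv_comm (hf : ContDiff ℝ (⊤ : ℕ∞) f) (e e' : ℝ × ℝ × ℝ × ℝ) :
    dirDeriv e (dirDeriv e' f) = dirDeriv e' (dirDeriv e f) := by
  have hd : Differentiable ℝ (fderiv ℝ f) :=
    (hf.fderiv_right (m := (⊤ : ℕ∞)) (by simp)).differentiable (by simp)
  have key : ∀ a b P, dirDeriv a (dirDeriv b f) P = fderiv ℝ (fderiv ℝ f) P a b := by
    intro a b P
    change fderiv ℝ (fun Q => fderiv ℝ f Q b) P a = _
    rw [fderiv_clm_apply (hd P) (differentiableAt_const b)]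
    simp
  funext P
  rw [key, key]
  have htwo : minSmoothness ℝ 2 ≤ ((⊤ : ℕ∞) : WithTop ℕ∞) := by
    rw [minSmoothness_of_isRCLikeNormedField]
    exact WithTop.coe_le_coe.mpr (le_top : (2 : ℕ∞) ≤ ⊤)
  exact (hf.contDiffAt.isSymmSndFDerivAt htwo).eq e e'

lemma dirDeriv_x_coord (e P : ℝ × ℝ × ℝ × ℝ) :
    dirDeriv e (fun Q => Q.2.1) P = e.2.1 := by
  have hd : HasFDerivAt (fun Q : ℝ × ℝ × ℝ × ℝ => Q.2.1) _ P :=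
    ((ContinuousLinearMap.fst ℝ ℝ (ℝ × ℝ)).comp
      (ContinuousLinearMap.snd ℝ ℝ (ℝ × ℝ × ℝ))).hasFDerivAt
  rw [dirDeriv, hd.fderiv]
  rfl

lemma dirDeriv_y_coord (e P : ℝ × ℝ × ℝ × ℝ) :
    dirDeriv e (fun Q => Q.2.2.1) P = e.2.2.1 := by
  have hd : HasFDerivAt (fun Q : ℝ × ℝ × ℝ × ℝ => Q.2.2.1) _ P :=
    ((ContinuousLinearMap.fst ℝ ℝ ℝ).comp ((ContinuousLinearMap.snd ℝ ℝ (ℝ × ℝ)).comp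
      (ContinuousLinearMap.snd ℝ ℝ (ℝ × ℝ × ℝ)))).hasFDerivAt
  rw [dirDeriv, hd.fderiv]
  rfl

lemma pt_eq_dirDeriv (hf : ContDiff ℝ (⊤ : ℕ∞) f) : pt f = dirDeriv (1, 0, 0, 0) f := by
  funext P
  have hc : HasDerivAt (fun w : ℝ => (w, P.2.1, P.2.2.1, P.2.2.2)) (1, 0, 0, 0) P.1 :=
    (hasDerivAt_id _).prodMk ((hasDerivAt_const _ _).prodMk
      ((hasDerivAt_const _ _).prodMk (hasDerivAt_const _ _)))
  exact ((hf.differentiable_of_top P).hasFDerivAt.comp_hasDerivAt P.1 hc).deriv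

lemma px_eq_dirDeriv (hf : ContDiff ℝ (⊤ : ℕ∞) f) : px f = dirDeriv (0, 1, 0, 0) f := by
  funext P
  have hc : HasDerivAt (fun w : ℝ => (P.1, w, P.2.2.1, P.2.2.2)) (0, 1, 0, 0) P.2.1 :=
    (hasDerivAt_const _ _).prodMk ((hasDerivAt_id _).prodMk
      ((hasDerivAt_const _ _).prodMk (hasDerivAt_const _ _)))
  exact ((hf.differentiable_of_top P).hasFDerivAt.comp_hasDerivAt P.2.1 hc).deriv

lemma py_eq_dirDeriv (hf : ContDiff ℝ (⊤ : ℕ∞) f) : py f = dirDeriv (0, 0, 1, 0) f := by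
  funext P
  have hc : HasDerivAt (fun w : ℝ => (P.1, P.2.1, w, P.2.2.2)) (0, 0, 1, 0) P.2.2.1 :=
    (hasDerivAt_const _ _).prodMk ((hasDerivAt_const _ _).prodMk
      ((hasDerivAt_id _).prodMk (hasDerivAt_const _ _)))
  exact ((hf.differentiable_of_top P).hasFDerivAt.comp_hasDerivAt P.2.2.1 hc).deriv

lemma pz_eq_dirDeriv (hf : ContDiff ℝ (⊤ : ℕ∞) f) : pz f = dirDeriv (0, 0, 0, 1) f := by
  funext P
  have hc : HasDerivAt (fun w : ℝ => (P.1, P.2.1, P.2.2.1, w)) (0, 0, 0, 1) P.2.2.2 :=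
    (hasDerivAt_const _ _).prodMk ((hasDerivAt_const _ _).prodMk
      ((hasDerivAt_const _ _).prodMk (hasDerivAt_id _)))
  exact ((hf.differentiable_of_top P).hasFDerivAt.comp_hasDerivAt P.2.2.2 hc).deriv

lemma J_eq_dirDeriv (hf : ContDiff ℝ (⊤ : ℕ∞) f) (hg : ContDiff ℝ (⊤ : ℕ∞) g) :
    J f g = fun P => dirDeriv (0, 1, 0, 0) f P * dirDeriv (0, 0, 1, 0) g P
      - dirDeriv (0, 0, 1, 0) f P * dirDeriv (0, 1, 0, 0) g P := by
  unfold J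
  rw [px_eq_dirDeriv hf, px_eq_dirDeriv hg, py_eq_dirDeriv hf, py_eq_dirDeriv hg]

lemma Eop_eq_dirDeriv (hf : ContDiff ℝ (⊤ : ℕ∞) f) :
    Eop f = fun P => P.2.1 * dirDeriv (0, 1, 0, 0) f P
      + P.2.2.1 * dirDeriv (0, 0, 1, 0) f P - 2 * f P := by
  unfold Eop
  rw [px_eq_dirDeriv hf, py_eq_dirDeriv hf]

lemma ContDiff.J (hf : ContDiff ℝ (⊤ : ℕ∞) f) (hg : ContDiff ℝ (⊤ : ℕ∞) g) :
    ContDiff ℝ (⊤ : ℕ∞) (J f g) := by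
  rw [J_eq_dirDeriv hf hg]
  exact ((hf.dirDeriv _).mul (hg.dirDeriv _)).sub ((hf.dirDeriv _).mul (hg.dirDeriv _))

lemma ContDiff.lap (hf : ContDiff ℝ (⊤ : ℕ∞) f) : ContDiff ℝ (⊤ : ℕ∞) (lap f) := by
  unfold _root_.lap
  rw [px_eq_dirDeriv hf, py_eq_dirDeriv hf, px_eq_dirDeriv (hf.dirDeriv _),
    py_eq_dirDeriv (hf.dirDeriv _)]
  exact ((hf.dirDeriv _).dirDeriv _).add ((hf.dirDeriv _).dirDeriv _)

lemma contDiff_x_coord : ContDiff ℝ (⊤ : ℕ∞) (fun Q : ℝ × ℝ × ℝ × ℝ => Q.2.1) := by fun_prop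

lemma contDiff_y_coord : ContDiff ℝ (⊤ : ℕ∞) (fun Q : ℝ × ℝ × ℝ × ℝ => Q.2.2.1) := by fun_prop

lemma ContDiff.Eop (hf : ContDiff ℝ (⊤ : ℕ∞) f) : ContDiff ℝ (⊤ : ℕ∞) (Eop f) := by
  rw [Eop_eq_dirDeriv hf]
  exact ((contDiff_x_coord.mul (hf.dirDeriv _)).add (contDiff_y_coord.mul (hf.dirDeriv _))).sub
    (contDiff_const.mul hf)

lemma J_swap (f g : ℝ × ℝ × ℝ × ℝ → ℝ) (P : ℝ × ℝ × ℝ × ℝ) : J f g P = -J g f P := by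
  simp only [J]
  ring

lemma J_add_left (hf : ContDiff ℝ (⊤ : ℕ∞) f) (hg : ContDiff ℝ (⊤ : ℕ∞) g)
    (hh : ContDiff ℝ (⊤ : ℕ∞) h) (P : ℝ × ℝ × ℝ × ℝ) :
    J (fun Q => f Q + g Q) h P = J f h P + J g h P := by
  simp only [J_eq_dirDeriv (hf.add hg) hh, J_eq_dirDeriv hf hh, J_eq_dirDeriv hg hh,
    dirDeriv_add hf hg]
  ring

lemma J_sub_left (hf : ContDiff ℝ (⊤ : ℕ∞) f) (hg : ContDiff ℝ (⊤ : ℕ∞) g)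
    (hh : ContDiff ℝ (⊤ : ℕ∞) h) (P : ℝ × ℝ × ℝ × ℝ) :
    J (fun Q => f Q - g Q) h P = J f h P - J g h P := by
  simp only [J_eq_dirDeriv (hf.sub hg) hh, J_eq_dirDeriv hf hh, J_eq_dirDeriv hg hh,
    dirDeriv_sub hf hg]
  ring

lemma J_const_mul_left (hf : ContDiff ℝ (⊤ : ℕ∞) f) (hh : ContDiff ℝ (⊤ : ℕ∞) h) (c : ℝ)
    (P : ℝ × ℝ × ℝ × ℝ) : J (fun Q => c * f Q) h P = c * J f h P := by
  simp only [J_eq_dirDeriv (contDiff_const.mul hf) hh, J_eq_dirDeriv hf hh,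
    dirDeriv_const_mul hf]
  ring

lemma J_add_right (hf : ContDiff ℝ (⊤ : ℕ∞) f) (hg : ContDiff ℝ (⊤ : ℕ∞) g)
    (hh : ContDiff ℝ (⊤ : ℕ∞) h) (P : ℝ × ℝ × ℝ × ℝ) :
    J h (fun Q => f Q + g Q) P = J h f P + J h g P := by
  rw [J_swap, J_add_left hf hg hh, J_swap h f, J_swap h g]
  ring

lemma J_const_mul_right (hf : ContDiff ℝ (⊤ : ℕ∞) f) (hh : ContDiff ℝ (⊤ : ℕ∞) h) (c : ℝ)
    (P : ℝ × ℝ × ℝ × ℝ) : J h (fun Q => c * f Q) P = c * J h f P := by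
  rw [J_swap, J_const_mul_left hf hh, J_swap h f]
  ring

lemma dirDeriv_J (hf : ContDiff ℝ (⊤ : ℕ∞) f) (hg : ContDiff ℝ (⊤ : ℕ∞) g)
    (e P : ℝ × ℝ × ℝ × ℝ) :
    dirDeriv e (J f g) P = J (dirDeriv e f) g P + J f (dirDeriv e g) P := by
  rw [J_eq_dirDeriv hf hg, J_eq_dirDeriv (hf.dirDeriv e) hg, J_eq_dirDeriv hf (hg.dirDeriv e),
    dirDeriv_sub ((hf.dirDeriv _).mul (hg.dirDeriv _)) ((hf.dirDeriv _).mul (hg.dirDeriv _)),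
    dirDeriv_mul (hf.dirDeriv _) (hg.dirDeriv _), dirDeriv_mul (hf.dirDeriv _) (hg.dirDeriv _)]
  simp only [dirDeriv_comm hf e, dirDeriv_comm hg e]
  ring

/-- The Jacobi identity, in the form that `J f` is a derivation of the bracket. -/
lemma J_J (hf : ContDiff ℝ (⊤ : ℕ∞) f) (hg : ContDiff ℝ (⊤ : ℕ∞) g)
    (hh : ContDiff ℝ (⊤ : ℕ∞) h) (P : ℝ × ℝ × ℝ × ℝ) :
    J f (J g h) P = J (J f g) h P + J g (J f h) P := by
  rw [J_eq_dirDeriv hf (hg.J hh), J_eq_dirDeriv (hf.J hg) hh, J_eq_dirDeriv hg (hf.J hh)]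
  simp only [dirDeriv_J hf hg, dirDeriv_J hg hh, dirDeriv_J hf hh]
  simp only [J_eq_dirDeriv (hf.dirDeriv _) hg, J_eq_dirDeriv (hf.dirDeriv _) hh,
    J_eq_dirDeriv (hg.dirDeriv _) hh, J_eq_dirDeriv hf (hg.dirDeriv _),
    J_eq_dirDeriv hf (hh.dirDeriv _), J_eq_dirDeriv hg (hh.dirDeriv _),
    dirDeriv_comm hf (0, 1, 0, 0) (0, 0, 1, 0), dirDeriv_comm hg (0, 1, 0, 0) (0, 0, 1, 0),
    dirDeriv_comm hh (0, 1, 0, 0) (0, 0, 1, 0)]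
  ring

lemma dirDeriv_Eop (hf : ContDiff ℝ (⊤ : ℕ∞) f) (e P : ℝ × ℝ × ℝ × ℝ) :
    dirDeriv e (Eop f) P = Eop (dirDeriv e f) P
      + e.2.1 * dirDeriv (0, 1, 0, 0) f P + e.2.2.1 * dirDeriv (0, 0, 1, 0) f P := by
  have hx := contDiff_x_coord.mul (hf.dirDeriv (0, 1, 0, 0))
  have hy := contDiff_y_coord.mul (hf.dirDeriv (0, 0, 1, 0))
  rw [Eop_eq_dirDeriv hf, Eop_eq_dirDeriv (hf.dirDeriv e),
    dirDeriv_sub (hx.add hy) (contDiff_const.mul hf), dirDeriv_add hx hy,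
    dirDeriv_mul contDiff_x_coord (hf.dirDeriv _), dirDeriv_mul contDiff_y_coord (hf.dirDeriv _),
    dirDeriv_const_mul hf, dirDeriv_x_coord, dirDeriv_y_coord]
  simp only [dirDeriv_comm hf e]
  ring

lemma Eop_sub (hf : ContDiff ℝ (⊤ : ℕ∞) f) (hg : ContDiff ℝ (⊤ : ℕ∞) g)
    (P : ℝ × ℝ × ℝ × ℝ) : Eop (fun Q => f Q - g Q) P = Eop f P - Eop g P := by
  simp only [Eop_eq_dirDeriv (hf.sub hg), Eop_eq_dirDeriv hf, Eop_eq_dirDeriv hg,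
    dirDeriv_sub hf hg]
  ring

lemma Eop_J (hf : ContDiff ℝ (⊤ : ℕ∞) f) (hg : ContDiff ℝ (⊤ : ℕ∞) g)
    (P : ℝ × ℝ × ℝ × ℝ) : Eop (J f g) P = J (Eop f) g P + J f (Eop g) P := by
  rw [Eop_eq_dirDeriv (hf.J hg), J_eq_dirDeriv hf.Eop hg, J_eq_dirDeriv hf hg.Eop]
  simp only [dirDeriv_J hf hg, dirDeriv_Eop hf, dirDeriv_Eop hg]
  simp only [J_eq_dirDeriv (hf.dirDeriv _) hg, J_eq_dirDeriv hf (hg.dirDeriv _),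
    J_eq_dirDeriv hf hg, Eop_eq_dirDeriv (hf.dirDeriv _), Eop_eq_dirDeriv (hg.dirDeriv _),
    dirDeriv_comm hf (0, 1, 0, 0) (0, 0, 1, 0), dirDeriv_comm hg (0, 1, 0, 0) (0, 0, 1, 0)]
  ring

end Calculus

/-- The cross-derivative identity of two first-order flows on `p` and `q`, written through the
brackets with the generators `u, v` and the coupling functions `a, b`. -/
lemma J_curvature_eq_zero {u v p q a b : ℝ × ℝ × ℝ × ℝ → ℝ} {e e' : ℝ × ℝ × ℝ × ℝ}
    (hu : ContDiff ℝ (⊤ : ℕ∞) u) (hv : ContDiff ℝ (⊤ : ℕ∞) v)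
    (hp : ContDiff ℝ (⊤ : ℕ∞) p) (hq : ContDiff ℝ (⊤ : ℕ∞) q)
    (ha : ContDiff ℝ (⊤ : ℕ∞) a) (hb : ContDiff ℝ (⊤ : ℕ∞) b)
    (hpe : dirDeriv e p = J u p) (hpe' : dirDeriv e' p = J v p)
    (hqe : dirDeriv e q = fun P => J u q P + J a p P)
    (hqe' : dirDeriv e' q = fun P => J v q P + J b p P) (P : ℝ × ℝ × ℝ × ℝ) :
    J (fun Q => dirDeriv e v Q - dirDeriv e' u Q - J u v Q) q P
      + J (fun Q => dirDeriv e b Q - dirDeriv e' a Q - J u b Q + J v a Q) p P = 0 := by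
  have hcross := congrFun (dirDeriv_comm hq e e') P
  rw [hqe, hqe', dirDeriv_add (hv.J hq) (hb.J hp), dirDeriv_add (hu.J hq) (ha.J hp),
    dirDeriv_J hv hq, dirDeriv_J hb hp, dirDeriv_J hu hq, dirDeriv_J ha hp, hqe, hqe', hpe, hpe',
    J_add_right (hu.J hq) (ha.J hp) hv, J_add_right (hv.J hq) (hb.J hp) hu,
    J_J hu hv hq, J_J hv ha hp, J_J hu hb hp] at hcross
  have hvu := (hv.dirDeriv e).sub (hu.dirDeriv e')
  have hba := (hb.dirDeriv e).sub (ha.dirDeriv e')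
  rw [J_sub_left hvu (hu.J hv) hq, J_sub_left (hv.dirDeriv e) (hu.dirDeriv e') hq,
    J_add_left (hba.sub (hu.J hb)) (hv.J ha) hp, J_sub_left hba (hu.J hb) hp,
    J_sub_left (hb.dirDeriv e) (ha.dirDeriv e') hp]
  linear_combination hcross

theorem rmhd_second_covering_compatibility
    (u v p q : ℝ × ℝ × ℝ × ℝ → ℝ) (l : ℝ)
    (hu : ContDiff ℝ (⊤ : ℕ∞) u) (hv : ContDiff ℝ (⊤ : ℕ∞) v)
    (hp : ContDiff ℝ (⊤ : ℕ∞) p) (hq : ContDiff ℝ (⊤ : ℕ∞) q)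
    (hpt : ∀ P, pt p P = J u p P)
    (hpz : ∀ P, pz p P = J v p P)
    (hqt : ∀ P, pt q P = J u q P + J (fun Q => lap v Q + l * Eop u Q) p P)
    (hqz : ∀ P, pz q P = J v q P + J (fun Q => lap u Q + l * Eop v Q) p P) :
    ∀ P, J (F2 u v) q P + J (fun Q => F1 u v Q + l * Eop (F2 u v) Q) p P = 0 := by
  have ha : ContDiff ℝ (⊤ : ℕ∞) (fun Q => lap v Q + l * Eop u Q) :=
    hv.lap.add (contDiff_const.mul hu.Eop)
  have hb : ContDiff ℝ (⊤ : ℕ∞) (fun Q => lap u Q + l * Eop v Q) :=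
    hu.lap.add (contDiff_const.mul hv.Eop)
  intro P
  have key := J_curvature_eq_zero hu hv hp hq ha hb
    ((pt_eq_dirDeriv hp).symm.trans (funext hpt)) ((pz_eq_dirDeriv hp).symm.trans (funext hpz))
    ((pt_eq_dirDeriv hq).symm.trans (funext hqt)) ((pz_eq_dirDeriv hq).symm.trans (funext hqz)) P
  have hF2 : F2 u v = fun Q =>
      dirDeriv (1, 0, 0, 0) v Q - dirDeriv (0, 0, 0, 1) u Q - J u v Q := by
    unfold F2
    rw [pt_eq_dirDeriv hv, pz_eq_dirDeriv hu]
  convert key using 3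
  funext Q
  rw [hF2, Eop_sub ((hv.dirDeriv _).sub (hu.dirDeriv _)) (hu.J hv),
    Eop_sub (hv.dirDeriv _) (hu.dirDeriv _), Eop_J hu hv, F1, pt_eq_dirDeriv hu.lap,
    pz_eq_dirDeriv hv.lap,
    dirDeriv_add hu.lap (contDiff_const.mul hv.Eop), dirDeriv_const_mul hv.Eop,
    dirDeriv_add hv.lap (contDiff_const.mul hu.Eop), dirDeriv_const_mul hu.Eop,
    dirDeriv_Eop hu, dirDeriv_Eop hv,
    J_add_right hu.lap (contDiff_const.mul hv.Eop) hu, J_const_mul_right hv.Eop hu,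
    J_add_right hv.lap (contDiff_const.mul hu.Eop) hv, J_const_mul_right hu.Eop hv,
    J_swap (Eop u) v]
  ring
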